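/- arXiv:math/0404473 — 2 statements merged into one kernel-verified Lean document; each statement's English description precedes it below -/
import Mathlib

section
/- Let G be a δ-hyperbolic group and let H₁ and H₂ be subgroups of G which are ε₁- and ε₂-quasiconvex respectively. If the Gromov products (h₁|h₂)_{1_G} for h₁ ∈ H₁, h₂ ∈ H₂ are unbounded (i.e. for every C ≥ 0 there exist h₁ ∈ H₁ and h₂ ∈ H₂ with (h₁|h₂)_{1_G} > C), then the intersection H₁ ∩ H₂ is infinite. -/
open Pointwise

section WordMetric

variable {G : Type*} [Group G]

/-- The word length of `g` with respect to a generating set `S`: the length of a shortest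
word in the letters of `S` representing `g`. -/
noncomputable def wordLength (S : Set G) (g : G) : ℕ :=
  sInf {n | ∃ l : List G, (∀ s ∈ l, s ∈ S) ∧ l.prod = g ∧ l.length = n}

/-- The word metric `d(x, y) = |x⁻¹ y|` associated with the generating set `S`,
viewed as a real number. -/
noncomputable def wdist (S : Set G) (x y : G) : ℝ :=
  (wordLength S (x⁻¹ * y) : ℝ)

/-- The Gromov product `(x|y)_w = ½ (d(x,w) + d(y,w) − d(x,y))`. -/
noncomputable def gromovProd (S : Set G) (x y w : G) : ℝ :=
  (wdist S x w + wdist S y w - wdist S x y) / 2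

/-- `z` lies between `x` and `y`: `d(x,z) + d(z,y) = d(x,y)`. -/
def LiesBetween (S : Set G) (x z y : G) : Prop :=
  wdist S x z + wdist S z y = wdist S x y

/-- `G` is `δ`-hyperbolic with respect to the word metric of `S`:
(i) the Gromov products satisfy the `δ`-inequality; (ii) triangles are `δ`-thin;
(iii) triangles are `δ`-slim. -/
def IsHyperbolicWith (S : Set G) (δ : ℝ) : Prop :=
  (∀ x y z w : G,
      gromovProd S x y w ≥ min (gromovProd S x z w) (gromovProd S y z w) - δ) ∧
  (∀ x y z p q : G, LiesBetween S x p y → LiesBetween S x q z →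
      wdist S x p = wdist S x q → wdist S x p ≤ gromovProd S y z x →
      wdist S p q ≤ δ) ∧
  (∀ x y z p : G, LiesBetween S x p y →
      ∃ q : G, (LiesBetween S x q z ∨ LiesBetween S z q y) ∧ wdist S p q ≤ δ)

/-- A subset `Q ⊆ G` is `ε`-quasiconvex: every point between two points of `Q`
is at distance at most `ε` from `Q`. -/
def IsEpsQuasiconvex (S : Set G) (ε : ℝ) (Q : Set G) : Prop :=
  ∀ x ∈ Q, ∀ y ∈ Q, ∀ z : G, LiesBetween S x z y → ∃ q ∈ Q, wdist S z q ≤ ε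

/-- A subset `Q ⊆ G` is quasiconvex if it is `ε`-quasiconvex for some `ε ≥ 0`. -/
def IsQuasiconvex (S : Set G) (Q : Set G) : Prop :=
  ∃ ε : ℝ, 0 ≤ ε ∧ IsEpsQuasiconvex S ε Q

/-- For subsets `B A` of a group `G`, `Prec B A` means `B ⪯ A`: there exist finitely many
elements `x₁, …, xₙ ∈ G` with `B ⊆ A x₁ ∪ ⋯ ∪ A xₙ`. -/
def Prec (B A : Set G) : Prop :=
  ∃ T : Finset G, B ⊆ A * (T : Set G)

/-- `A ≈ B` : `A ⪯ B` and `B ⪯ A`. -/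
def Approx (A B : Set G) : Prop :=
  Prec A B ∧ Prec B A

/-- A subset `A` is quasidense if `G ⪯ A`. -/
def Quasidense (A : Set G) : Prop :=
  Prec (Set.univ : Set G) A

/-- The conjugate subgroup `gHg⁻¹`. -/
def conjSubgroup (g : G) (H : Subgroup G) : Subgroup G :=
  H.map (MulAut.conj g).toMonoidHom

/-- `H^G = {g h g⁻¹ : h ∈ H, g ∈ G}`, the union of all conjugates of `H`. -/
def conjUnion (H : Subgroup G) : Set G :=
  {x | ∃ g : G, ∃ h ∈ H, x = g * h * g⁻¹}

/-- The quasiconvex product `f₀ G₁ f₁ G₂ ⋯ f_{n−1} G_n f_n` determined by the subgroups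
`H 0, …, H (n-1)` and the elements `f 0, …, f n`. -/
def quasiconvexProduct (n : ℕ) (f : Fin (n + 1) → G) (H : Fin n → Subgroup G) : Set G :=
  {x | ∃ g : Fin n → G, (∀ i, g i ∈ H i) ∧
        x = f 0 * (List.ofFn fun i : Fin n => g i * f i.succ).prod}

end WordMetric

section WordLength

variable {G : Type*} [Group G] {S : Set G}

lemma wordLength_prod_le (l : List G) (hl : ∀ s ∈ l, s ∈ S) :
    wordLength S l.prod ≤ l.length :=
  Nat.sInf_le ⟨l, hl, rfl, rfl⟩

lemma exists_word_length_eq (hSsym : ∀ s ∈ S, s⁻¹ ∈ S) (hSgen : Subgroup.closure S = ⊤) (g : G) :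
    ∃ l : List G, (∀ s ∈ l, s ∈ S) ∧ l.prod = g ∧ l.length = wordLength S g := by
  have hg : g ∈ (Subgroup.closure S).toSubmonoid := hSgen ▸ Subgroup.mem_top g
  rw [Subgroup.closure_toSubmonoid,
    Set.union_eq_left.2 fun s hs => by simpa using hSsym _ hs] at hg
  obtain ⟨l, hl, hprod⟩ := Submonoid.exists_list_of_mem_closure hg
  exact Nat.sInf_mem (s := {n | ∃ l : List G, (∀ s ∈ l, s ∈ S) ∧ l.prod = g ∧ l.length = n})
    ⟨l.length, l, hl, hprod, rfl⟩

lemma wordLength_mul_le (hSsym : ∀ s ∈ S, s⁻¹ ∈ S) (hSgen : Subgroup.closure S = ⊤) (g h : G) :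
    wordLength S (g * h) ≤ wordLength S g + wordLength S h := by
  obtain ⟨l, hl, hlg, hlen⟩ := exists_word_length_eq hSsym hSgen g
  obtain ⟨m, hm, hmh, hmlen⟩ := exists_word_length_eq hSsym hSgen h
  have key := wordLength_prod_le (S := S) (l ++ m) fun s hs =>
    (List.mem_append.1 hs).elim (hl s) (hm s)
  rwa [List.prod_append, List.length_append, hlg, hmh, hlen, hmlen] at key

lemma wordLength_inv_le (hSsym : ∀ s ∈ S, s⁻¹ ∈ S) (hSgen : Subgroup.closure S = ⊤) (g : G) :
    wordLength S g⁻¹ ≤ wordLength S g := by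
  obtain ⟨l, hl, hlg, hlen⟩ := exists_word_length_eq hSsym hSgen g
  have key := wordLength_prod_le (S := S) (l.map (·⁻¹)).reverse fun s hs => by
    obtain ⟨t, ht, rfl⟩ := List.mem_map.1 (List.mem_reverse.1 hs)
    exact hSsym t (hl t ht)
  rwa [← List.prod_inv_reverse, List.length_reverse, List.length_map, hlg, hlen] at key

lemma wdist_comm (hSsym : ∀ s ∈ S, s⁻¹ ∈ S) (hSgen : Subgroup.closure S = ⊤) (x y : G) :
    wdist S x y = wdist S y x := by
  have h₁ := wordLength_inv_le hSsym hSgen (x⁻¹ * y)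
  have h₂ := wordLength_inv_le hSsym hSgen (y⁻¹ * x)
  simp only [mul_inv_rev, inv_inv] at h₁ h₂
  exact congrArg Nat.cast (le_antisymm h₂ h₁)

lemma wdist_triangle (hSsym : ∀ s ∈ S, s⁻¹ ∈ S) (hSgen : Subgroup.closure S = ⊤) (x y z : G) :
    wdist S x z ≤ wdist S x y + wdist S y z := by
  have h := wordLength_mul_le hSsym hSgen (x⁻¹ * y) (y⁻¹ * z)
  rw [show x⁻¹ * y * (y⁻¹ * z) = x⁻¹ * z by group] at h
  simp only [wdist]
  exact_mod_cast h

lemma gromovProd_le_left (hSsym : ∀ s ∈ S, s⁻¹ ∈ S) (hSgen : Subgroup.closure S = ⊤)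
    (x y w : G) : gromovProd S x y w ≤ wdist S w x := by
  have h := wdist_triangle hSsym hSgen y x w
  rw [wdist_comm hSsym hSgen y x] at h
  rw [gromovProd, wdist_comm hSsym hSgen w x]
  linarith

lemma gromovProd_comm (hSsym : ∀ s ∈ S, s⁻¹ ∈ S) (hSgen : Subgroup.closure S = ⊤)
    (x y w : G) : gromovProd S x y w = gromovProd S y x w := by
  rw [gromovProd, gromovProd, wdist_comm hSsym hSgen x y, add_comm (wdist S x w)]

/-- Balls in the word metric of a finite generating set are finite. -/
lemma finite_setOf_wordLength_le (hSfin : S.Finite) (hSsym : ∀ s ∈ S, s⁻¹ ∈ S)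
    (hSgen : Subgroup.closure S = ⊤) (n : ℕ) : {g : G | wordLength S g ≤ n}.Finite := by
  have : Finite S := hSfin
  refine ((List.finite_length_le S n).image
    fun l => (l.map Subtype.val).prod).subset fun g hg => ?_
  obtain ⟨l, hl, hlg, hlen⟩ := exists_word_length_eq hSsym hSgen g
  lift l to List S using hl
  exact ⟨l, by simpa using hlen.trans_le hg, hlg⟩

/-- Every element is joined to the identity by a geodesic. -/
lemma exists_liesBetween_one (hSsym : ∀ s ∈ S, s⁻¹ ∈ S) (hSgen : Subgroup.closure S = ⊤)
    (g : G) (k : ℕ) (hk : (k : ℝ) ≤ wdist S 1 g) :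
    ∃ p : G, LiesBetween S 1 p g ∧ wdist S 1 p = k := by
  obtain ⟨l, hl, hlg, hlen⟩ := exists_word_length_eq hSsym hSgen g
  have hsplit : (l.take k).prod * (l.drop k).prod = g := by
    rw [List.prod_take_mul_prod_drop, hlg]
  have htake := wordLength_prod_le (S := S) (l.take k) fun s hs => hl s (List.mem_of_mem_take hs)
  have hdrop := wordLength_prod_le (S := S) (l.drop k) fun s hs => hl s (List.mem_of_mem_drop hs)
  have htri := wordLength_mul_le hSsym hSgen (l.take k).prod (l.drop k).prod
  have hrest : (l.take k).prod⁻¹ * g = (l.drop k).prod := by rw [← hsplit]; group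
  simp only [wdist, inv_one, one_mul, Nat.cast_le] at hk
  rw [List.length_take] at htake
  rw [List.length_drop] at hdrop
  rw [hsplit] at htri
  refine ⟨(l.take k).prod, ?_, ?_⟩
  · simp only [LiesBetween, wdist, inv_one, one_mul, hrest]
    norm_cast
    omega
  · simp only [wdist, inv_one, one_mul, Nat.cast_inj]
    omega

end WordLength

/-- If `H₁ ∩ H₂` is finite, only finitely many elements of `H₁` can be moved into `H₂` by right
multiplication by an element of a given finite set. -/
lemma Subgroup.finite_setOf_exists_mul_mem {G : Type*} [Group G] {H₁ H₂ : Subgroup G}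
    (hfin : ((H₁ : Set G) ∩ (H₂ : Set G)).Finite) {B : Set G} (hB : B.Finite) :
    {a : G | a ∈ H₁ ∧ ∃ u ∈ B, a * u ∈ H₂}.Finite := by
  have hfiber : ∀ u : G, {a : G | a ∈ H₁ ∧ a * u ∈ H₂}.Finite := by
    intro u
    rcases Set.eq_empty_or_nonempty {a : G | a ∈ H₁ ∧ a * u ∈ H₂} with h | ⟨c, hc₁, hc₂⟩
    · exact h ▸ Set.finite_empty
    · refine (hfin.image (· * c)).subset fun a ⟨ha₁, ha₂⟩ => ⟨a * c⁻¹, ⟨?_, ?_⟩, by simp⟩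
      · exact H₁.mul_mem ha₁ (H₁.inv_mem hc₁)
      · have h := H₂.mul_mem ha₂ (H₂.inv_mem hc₂)
        rwa [show a * u * (c * u)⁻¹ = a * c⁻¹ by group] at h
  refine (hB.biUnion fun u _ => hfiber u).subset ?_
  rintro a ⟨ha, u, hu, hau⟩
  exact Set.mem_biUnion hu ⟨ha, hau⟩

/-- Let `G` be `δ`-hyperbolic and `H₁, H₂ ≤ G` be `ε₁`- and `ε₂`-quasiconvex respectively.
If the Gromov products `(h₁|h₂)_{1}` for `h₁ ∈ H₁`, `h₂ ∈ H₂` are unbounded, then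
`H₁ ∩ H₂` is infinite. -/
theorem infinite_intersection_of_unbounded_gromov_products
    {G : Type*} [Group G] (S : Set G) (hSfin : S.Finite)
    (hSsym : ∀ s ∈ S, s⁻¹ ∈ S) (hSgen : Subgroup.closure S = ⊤)
    (δ : ℝ) (hδ : 0 ≤ δ) (hhyp : IsHyperbolicWith S δ)
    (H₁ H₂ : Subgroup G)
    (ε₁ : ℝ) (hε₁ : 0 ≤ ε₁) (hH₁ : IsEpsQuasiconvex S ε₁ (H₁ : Set G))
    (ε₂ : ℝ) (hε₂ : 0 ≤ ε₂) (hH₂ : IsEpsQuasiconvex S ε₂ (H₂ : Set G))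
    (hub : ∀ C : ℝ, 0 ≤ C → ∃ h₁ ∈ H₁, ∃ h₂ ∈ H₂, gromovProd S h₁ h₂ 1 > C) :
    ((H₁ : Set G) ∩ (H₂ : Set G)).Infinite := by
  intro hfin
  have hB := finite_setOf_wordLength_le hSfin hSsym hSgen ⌊ε₁ + δ + ε₂⌋₊
  obtain ⟨M, hM⟩ := ((Subgroup.finite_setOf_exists_mul_mem hfin hB).image (wdist S 1)).bddAbove
  obtain ⟨k, hk⟩ := exists_nat_gt (M + ε₁)
  obtain ⟨h₁, hh₁, h₂, hh₂, hprod⟩ := hub k k.cast_nonneg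
  have hle₁ := gromovProd_le_left hSsym hSgen h₁ h₂ 1
  have hle₂ := gromovProd_le_left hSsym hSgen h₂ h₁ 1
  rw [gromovProd_comm hSsym hSgen] at hle₂
  obtain ⟨p, hp, hpk⟩ := exists_liesBetween_one hSsym hSgen h₁ k (hprod.le.trans hle₁)
  obtain ⟨q, hq, hqk⟩ := exists_liesBetween_one hSsym hSgen h₂ k (hprod.le.trans hle₂)
  have hpq : wdist S p q ≤ δ :=
    hhyp.2.1 1 h₁ h₂ p q hp hq (hpk.trans hqk.symm) (hpk.trans_le hprod.le)
  obtain ⟨a, ha, hpa⟩ := hH₁ 1 H₁.one_mem h₁ hh₁ p hp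
  obtain ⟨b, hb, hqb⟩ := hH₂ 1 H₂.one_mem h₂ hh₂ q hq
  have hap : wdist S a p ≤ ε₁ := wdist_comm hSsym hSgen a p ▸ hpa
  have hab : wdist S a b ≤ ε₁ + δ + ε₂ := by
    linarith [wdist_triangle hSsym hSgen a p b, wdist_triangle hSsym hSgen p q b]
  have haM : wdist S 1 a ≤ M :=
    hM ⟨a, ⟨ha, a⁻¹ * b, Nat.le_floor hab, by simpa using hb⟩, rfl⟩
  linarith [wdist_triangle hSsym hSgen 1 a p]
end

section
/- Let G be a non-elementary δ-hyperbolic group and let A be a subset of G containing an infinite normal subset B (i.e. B is infinite and gBg⁻¹ = B for every g ∈ G). Then A is quasiconvex if and only if A is quasidense in G. -/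
open Pointwise

open Filter

section Geometry

variable {G : Type*} [Group G] {S : Set G}

/-- `S` is closed under inverses and generates `G`. -/
structure IsSymmGen (S : Set G) : Prop where
  inv_mem : ∀ s ∈ S, s⁻¹ ∈ S
  closure_eq_top : Subgroup.closure S = ⊤

theorem wordLength_le_length {l : List G} (hl : ∀ s ∈ l, s ∈ S) :
    wordLength S l.prod ≤ l.length :=
  Nat.sInf_le ⟨l, hl, rfl, rfl⟩

theorem wordLength_one : wordLength S (1 : G) = 0 := by
  simpa using wordLength_le_length (S := S) (l := []) (by simp)

namespace IsSymmGen

theorem exists_word (hS : IsSymmGen S) (g : G) :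
    ∃ l : List G, (∀ s ∈ l, s ∈ S) ∧ l.prod = g ∧ l.length = wordLength S g := by
  have hne : {n | ∃ l : List G, (∀ s ∈ l, s ∈ S) ∧ l.prod = g ∧ l.length = n}.Nonempty := by
    have hg : g ∈ (Subgroup.closure S).toSubmonoid := by simp [hS.closure_eq_top]
    rw [Subgroup.closure_toSubmonoid] at hg
    obtain ⟨l, hl, hprod⟩ := Submonoid.exists_list_of_mem_closure hg
    refine ⟨l.length, l, fun s hs => ?_, hprod, rfl⟩
    rcases hl s hs with h | h
    · exact h
    · simpa using hS.inv_mem _ h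
  exact Nat.sInf_mem hne

theorem wordLength_mul_le (hS : IsSymmGen S) (g h : G) :
    wordLength S (g * h) ≤ wordLength S g + wordLength S h := by
  obtain ⟨l, hl, rfl, hlen⟩ := hS.exists_word g
  obtain ⟨l', hl', rfl, hlen'⟩ := hS.exists_word h
  rw [← hlen, ← hlen', ← List.prod_append, ← List.length_append]
  refine wordLength_le_length fun s hs => ?_
  rcases List.mem_append.1 hs with h | h
  exacts [hl s h, hl' s h]

theorem wordLength_inv_le (hS : IsSymmGen S) (g : G) :
    wordLength S g⁻¹ ≤ wordLength S g := by
  obtain ⟨l, hl, rfl, hlen⟩ := hS.exists_word g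
  rw [← hlen, List.prod_inv_reverse]
  refine (wordLength_le_length fun s hs => ?_).trans (by simp)
  simp only [List.mem_reverse, List.mem_map] at hs
  obtain ⟨t, ht, rfl⟩ := hs
  exact hS.inv_mem t (hl t ht)

theorem wordLength_inv (hS : IsSymmGen S) (g : G) : wordLength S g⁻¹ = wordLength S g :=
  (hS.wordLength_inv_le g).antisymm (by simpa using hS.wordLength_inv_le g⁻¹)

theorem exists_initial_segment (hS : IsSymmGen S) (g : G) {k : ℕ} (hk : k ≤ wordLength S g) :
    ∃ a : G, wordLength S a = k ∧ k + wordLength S (a⁻¹ * g) = wordLength S g := by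
  obtain ⟨l, hl, rfl, hlen⟩ := hS.exists_word g
  have hsplit := List.prod_take_mul_prod_drop l k
  have htake : wordLength S (l.take k).prod ≤ k :=
    (wordLength_le_length fun s hs => hl s (List.mem_of_mem_take hs)).trans (by simp)
  have hdrop : wordLength S (l.drop k).prod ≤ l.length - k :=
    (wordLength_le_length fun s hs => hl s (List.mem_of_mem_drop hs)).trans (by simp)
  have hmul := hS.wordLength_mul_le (l.take k).prod (l.drop k).prod
  rw [hsplit] at hmul
  refine ⟨(l.take k).prod, by omega, ?_⟩
  have : (l.take k).prod⁻¹ * l.prod = (l.drop k).prod := by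
    rw [← hsplit, inv_mul_cancel_left]
  rw [this]
  omega

theorem finite_wordLength_le (hS : IsSymmGen S) (hfin : S.Finite) (n : ℕ) :
    {g : G | wordLength S g ≤ n}.Finite := by
  have := hfin.to_subtype
  refine ((List.finite_length_le S n).image fun l => (l.map Subtype.val).prod).subset ?_
  intro g hg
  obtain ⟨l, hl, rfl, hlen⟩ := hS.exists_word g
  lift l to List S using hl
  refine ⟨l, ?_, rfl⟩
  simp only [List.length_map] at hlen
  simpa [hlen] using hg

theorem finite_wdist_one_le (hS : IsSymmGen S) (hfin : S.Finite) (r : ℝ) :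
    {g : G | wdist S 1 g ≤ r}.Finite := by
  refine (hS.finite_wordLength_le hfin ⌊r⌋₊).subset fun g hg => ?_
  simp only [Set.mem_ofPred_eq, wdist, inv_one, one_mul] at hg
  exact Nat.le_floor hg

end IsSymmGen

theorem wdist_nonneg (x y : G) : 0 ≤ wdist S x y := Nat.cast_nonneg _

theorem wdist_self (x : G) : wdist S x x = 0 := by simp [wdist, wordLength_one]

theorem wdist_mul_left (g x y : G) : wdist S (g * x) (g * y) = wdist S x y := by
  simp [wdist, mul_assoc]

theorem gromovProd_mul_left (g x y w : G) :
    gromovProd S (g * x) (g * y) (g * w) = gromovProd S x y w := by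
  simp [gromovProd, wdist_mul_left]

namespace IsSymmGen

theorem wdist_comm (hS : IsSymmGen S) (x y : G) : wdist S x y = wdist S y x := by
  rw [wdist, wdist, ← hS.wordLength_inv]
  simp

theorem wdist_triangle (hS : IsSymmGen S) (x y z : G) :
    wdist S x z ≤ wdist S x y + wdist S y z := by
  have := hS.wordLength_mul_le (x⁻¹ * y) (y⁻¹ * z)
  rw [show x⁻¹ * y * (y⁻¹ * z) = x⁻¹ * z by group] at this
  simp only [wdist]
  exact_mod_cast this

theorem gromovProd_comm (hS : IsSymmGen S) (x y w : G) :
    gromovProd S x y w = gromovProd S y x w := by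
  simp only [gromovProd, hS.wdist_comm x y]
  ring

theorem gromovProd_le_left (hS : IsSymmGen S) (x y w : G) :
    gromovProd S x y w ≤ wdist S x w := by
  have := hS.wdist_triangle y x w
  rw [gromovProd, hS.wdist_comm x y]
  linarith

theorem gromovProd_le_right (hS : IsSymmGen S) (x y w : G) :
    gromovProd S x y w ≤ wdist S y w := by
  rw [hS.gromovProd_comm]
  exact hS.gromovProd_le_left y x w

theorem gromovProd_nonneg (hS : IsSymmGen S) (x y w : G) : 0 ≤ gromovProd S x y w := by
  have := hS.wdist_triangle x w y
  rw [hS.wdist_comm w y] at this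
  rw [gromovProd]
  linarith

theorem gromovProd_le_add_wdist (hS : IsSymmGen S) (x y w w' : G) :
    gromovProd S x y w ≤ gromovProd S x y w' + wdist S w w' := by
  have h₁ := hS.wdist_triangle x w' w
  have h₂ := hS.wdist_triangle y w' w
  rw [hS.wdist_comm w' w] at h₁ h₂
  simp only [gromovProd]
  linarith

theorem gromovProd_le_add_wdist_left (hS : IsSymmGen S) (x x' y w : G) :
    gromovProd S x y w ≤ gromovProd S x' y w + wdist S x x' := by
  have h₁ := hS.wdist_triangle x x' w
  have h₂ := hS.wdist_triangle x' x y
  rw [hS.wdist_comm x' x] at h₂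
  simp only [gromovProd]
  linarith

/-- Left translation by `g` moves Gromov products at `1` by at most `|g|`. -/
theorem gromovProd_le_mul_left (hS : IsSymmGen S) (g x y : G) :
    gromovProd S x y 1 ≤ gromovProd S (g * x) (g * y) 1 + wdist S 1 g := by
  have h := hS.gromovProd_le_add_wdist (g * x) (g * y) (g * 1) 1
  rwa [gromovProd_mul_left, mul_one, hS.wdist_comm g 1] at h

theorem exists_liesBetween (hS : IsSymmGen S) (x y : G) {k : ℕ} (hk : (k : ℝ) ≤ wdist S x y) :
    ∃ z, LiesBetween S x z y ∧ wdist S x z = k := by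
  obtain ⟨a, ha, hsum⟩ := hS.exists_initial_segment (x⁻¹ * y) (Nat.cast_le.1 hk)
  refine ⟨x * a, ?_, by simp [wdist, ha]⟩
  simp only [LiesBetween, wdist, inv_mul_cancel_left, mul_inv_rev, ha, mul_assoc]
  exact_mod_cast hsum

/-- In a hyperbolic group a geodesic from `u` to `v` passes close to `x`
when `(u|v)_x` is small. -/
theorem exists_liesBetween_wdist_le (hS : IsSymmGen S) {δ : ℝ} (hhyp : IsHyperbolicWith S δ)
    (u v x : G) :
    ∃ z, LiesBetween S u z v ∧ wdist S x z ≤ gromovProd S u v x + 1 + 2 * δ := by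
  have h0 := hS.gromovProd_nonneg v x u
  have hk := Nat.floor_le h0
  have hk' := Nat.lt_floor_add_one (gromovProd S v x u)
  have hle := hS.gromovProd_le_left v x u
  rw [hS.wdist_comm v u] at hle
  obtain ⟨z, hz, hd⟩ := hS.exists_liesBetween u v (hk.trans hle)
  refine ⟨z, hz, ?_⟩
  have hfour := hhyp.1 x z v u
  rw [← hd] at hk hk'
  simp only [LiesBetween] at hz
  have c₁ := hS.wdist_comm x u
  have c₂ := hS.wdist_comm z u
  have c₃ := hS.wdist_comm v u
  have c₄ := hS.wdist_comm x v
  rcases min_choice (gromovProd S x v u) (gromovProd S z v u) with h | h <;>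
    rw [h] at hfour <;> simp only [gromovProd] at * <;> linarith

/-- The function `h ↦ d(h,u) - d(w,u)` barely depends on `u` once `u` is seen from `w` in a given
direction beyond distance `d(h,w)`. -/
theorem abs_busemann_sub_le (hS : IsSymmGen S) {δ : ℝ} (hhyp : IsHyperbolicWith S δ)
    {h u v w : G} (huv : wdist S h w ≤ gromovProd S u v w) :
    |(wdist S h u - wdist S w u) - (wdist S h v - wdist S w v)| ≤ 2 * δ := by
  have h₁ := hhyp.1 h u v w
  have h₂ := hhyp.1 h v u w
  rw [min_eq_left ((hS.gromovProd_le_left _ _ _).trans huv)] at h₁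
  rw [hS.gromovProd_comm v u, min_eq_left ((hS.gromovProd_le_left _ _ _).trans huv)] at h₂
  simp only [gromovProd] at h₁ h₂
  rw [hS.wdist_comm u w, hS.wdist_comm v w] at h₁ h₂
  rw [abs_le]
  constructor <;> linarith

/-- If `g` almost fixes a far away point `p` and moves it by a bounded horofunction amount,
then it displaces the points of `[1, p]` at moderate distance from `1` by a bounded amount. -/
theorem wdist_mul_le_of_busemann (hS : IsSymmGen S) {δ : ℝ} (hδ : 0 ≤ δ)
    (hhyp : IsHyperbolicWith S δ) {g t p : G} {C : ℝ} (hC : 0 ≤ C) (ht : LiesBetween S 1 t p)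
    (hg : wdist S g⁻¹ 1 ≤ wdist S 1 t) (hp : wdist S 1 t ≤ gromovProd S p (g * p) 1)
    (hβ : |wdist S g⁻¹ p - wdist S 1 p| ≤ C) :
    wdist S t (g * t) ≤ 3 * C + 8 * δ := by
  simp only [LiesBetween] at ht
  have htp : gromovProd S t p 1 = wdist S 1 t := by
    rw [gromovProd, hS.wdist_comm t 1, hS.wdist_comm p 1]
    linarith
  have hcmp := hS.abs_busemann_sub_le hhyp (h := g⁻¹) (u := t) (v := p) (w := 1)
    (hg.trans htp.ge)
  rw [abs_le] at hcmp hβ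
  have e₁ : ∀ x, wdist S (g * x) 1 = wdist S g⁻¹ x := fun x => by
    rw [← wdist_mul_left g g⁻¹ x, mul_inv_cancel, hS.wdist_comm]
  have hgtp : gromovProd S (g * t) (g * p) 1 ≥ wdist S 1 t - C - δ := by
    rw [gromovProd, e₁, e₁, wdist_mul_left]
    linarith
  have h₁ := hhyp.1 (g * t) p (g * p) 1
  have h₂ := hhyp.1 t (g * t) p 1
  have h₁' : wdist S 1 t - C - δ ≤
      min (gromovProd S (g * t) (g * p) 1) (gromovProd S p (g * p) 1) :=
    le_min hgtp (by linarith)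
  have h₂' : wdist S 1 t - C - 2 * δ ≤
      min (gromovProd S t p 1) (gromovProd S (g * t) p 1) :=
    le_min (by linarith) (by linarith)
  have h₃ : wdist S 1 t - C - 3 * δ ≤ gromovProd S t (g * t) 1 := by linarith
  rw [gromovProd, e₁, hS.wdist_comm t 1] at h₃
  linarith

end IsSymmGen

/-- A quasimorphism-like function with finite sublevel sets on a finite index subgroup forces the
group to be virtually cyclic. -/
theorem exists_index_zpowers_ne_zero_of_quasimorphism [Infinite G] (H : Subgroup G) [H.FiniteIndex]
    (β : G → ℤ) {D : ℝ}
    (hβ : ∀ g ∈ H, ∀ h, |(β (g * h) : ℝ) - β g - β h| ≤ D)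
    (hfin : ∀ C : ℝ, {g | g ∈ H ∧ |(β g : ℝ)| ≤ C}.Finite) :
    ∃ g : G, (Subgroup.zpowers g).index ≠ 0 := by
  have hHinf : (H : Set G).Infinite := by
    intro hH
    have hcard := H.card_mul_index
    have : Finite H := hH
    have : Nat.card G ≠ 0 := by
      rw [← hcard]
      exact mul_ne_zero Nat.card_pos.ne' Subgroup.FiniteIndex.index_ne_zero
    exact this Nat.card_eq_zero_of_infinite
  obtain ⟨g, hgH, hg⟩ : ∃ g ∈ H, D < |(β g : ℝ)| := by
    by_contra! hcon
    exact hHinf ((hfin D).subset fun g hg => ⟨hg, hcon g hg⟩)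
  refine ⟨g, ?_⟩
  have hreduce : ∀ h ∈ H, ∃ k : ℤ, |(β (g ^ k * h) : ℝ)| ≤ |(β g : ℝ)| + D := by
    intro h hh
    obtain ⟨k, -, hk⟩ := WellFounded.has_min (measure fun k : ℤ => (β (g ^ k * h)).natAbs).wf
      Set.univ ⟨0, trivial⟩
    have hmin : ∀ j : ℤ, |(β (g ^ k * h) : ℝ)| ≤ |(β (g ^ j * h) : ℝ)| := fun j => by
      have : (β (g ^ k * h)).natAbs ≤ (β (g ^ j * h)).natAbs := not_lt.1 (hk j trivial)
      rw [← Int.cast_abs, ← Int.cast_abs, Int.abs_eq_natAbs, Int.abs_eq_natAbs]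
      exact_mod_cast this
    refine ⟨k, ?_⟩
    by_contra! hlt
    have hup := hβ g hgH (g ^ k * h)
    have hdown := hβ g hgH (g ^ (k - 1) * h)
    have e₁ : g * (g ^ k * h) = g ^ (k + 1) * h := by
      rw [← mul_assoc, ← zpow_one_add, add_comm]
    have e₂ : g * (g ^ (k - 1) * h) = g ^ k * h := by
      rw [← mul_assoc, ← zpow_one_add]; congr 2; ring
    rw [e₁] at hup
    rw [e₂] at hdown
    have m₁ := hmin (k + 1)
    have m₂ := hmin (k - 1)
    generalize (β (g ^ k * h) : ℝ) = x at *
    generalize (β (g ^ (k + 1) * h) : ℝ) = y at *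
    generalize (β (g ^ (k - 1) * h) : ℝ) = z at *
    generalize (β g : ℝ) = b at *
    rw [abs_le] at hup hdown
    rcases abs_cases x with hx | hx <;> rcases abs_cases y with hy | hy <;>
      rcases abs_cases z with hz | hz <;> rcases abs_cases b with hb | hb <;> linarith
  have hE := hfin (|(β g : ℝ)| + D)
  set E := {x | x ∈ H ∧ |(β x : ℝ)| ≤ |(β g : ℝ)| + D} with hEdef
  have hrel : (Subgroup.zpowers g).relIndex H ≠ 0 := by
    have : Finite (H ⧸ (Subgroup.zpowers g).subgroupOf H) := by
      have := hE.to_subtype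
      refine Finite.of_surjective
        (fun e : E => QuotientGroup.mk (s := (Subgroup.zpowers g).subgroupOf H)
          (⟨e.1, e.2.1⟩ : H)⁻¹) fun q => ?_
      obtain ⟨h, rfl⟩ := QuotientGroup.mk_surjective q
      obtain ⟨k, hk⟩ := hreduce h⁻¹ (H.inv_mem h.2)
      refine ⟨⟨g ^ k * (h : G)⁻¹, H.mul_mem (H.zpow_mem hgH k) (H.inv_mem h.2), hk⟩, ?_⟩
      rw [QuotientGroup.eq]
      simp only [Subgroup.mem_subgroupOf]
      exact ⟨k, by simp⟩
    exact Subgroup.index_ne_zero_of_finite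
  have hle : Subgroup.zpowers g ≤ H := by simpa using hgH
  rw [← Subgroup.relIndex_mul_index hle]
  exact mul_ne_zero hrel Subgroup.FiniteIndex.index_ne_zero

/-- A hyperbolic group is virtually cyclic if a finite index subgroup coarsely fixes a sequence of
points going to infinity. -/
theorem IsSymmGen.exists_index_zpowers_ne_zero_of_tendsto [Infinite G] (hS : IsSymmGen S)
    (hSfin : S.Finite) {δ : ℝ} (hδ : 0 ≤ δ) (hhyp : IsHyperbolicWith S δ)
    (U : Ultrafilter ℕ) (p : ℕ → G) (H : Subgroup G) [H.FiniteIndex]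
    (hH : ∀ g ∈ H, Tendsto (fun n => gromovProd S (p n) (g * p n) 1) U atTop) :
    ∃ g : G, (Subgroup.zpowers g).index ≠ 0 := by
  have hβ : ∀ g : G, ∃ b : ℤ, ∀ᶠ n in U, wdist S g (p n) - wdist S 1 (p n) = b := by
    intro g
    have hbdd : ∀ᶠ n in U, ∃ b ∈ Set.Icc (-(wordLength S g : ℤ)) (wordLength S g),
        wdist S g (p n) - wdist S 1 (p n) = (b : ℝ) := by
      refine Eventually.of_forall fun n =>
        ⟨wordLength S (g⁻¹ * p n) - wordLength S ((1 : G)⁻¹ * p n), ?_, by simp [wdist]⟩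
      have h₁ := hS.wordLength_mul_le g (g⁻¹ * p n)
      have h₂ := hS.wordLength_mul_le g⁻¹ (p n)
      rw [hS.wordLength_inv] at h₂
      rw [mul_inv_cancel_left] at h₁
      rw [inv_one, one_mul, Set.mem_Icc]
      omega
    obtain ⟨b, -, hb⟩ := (Ultrafilter.eventually_exists_mem_iff (Set.finite_Icc _ _)).1 hbdd
    exact ⟨b, hb⟩
  choose β hβ using hβ
  refine exists_index_zpowers_ne_zero_of_quasimorphism H β (D := 2 * δ) ?_ ?_
  · intro g hg h
    have hfar := (hH g⁻¹ (H.inv_mem hg)).eventually_ge_atTop (wdist S h 1)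
    obtain ⟨n, hn, h₁, h₂, h₃⟩ :=
      (hfar.and ((hβ g).and ((hβ h).and (hβ (g * h))))).exists
    have hcmp := hS.abs_busemann_sub_le hhyp hn
    have e₁ : wdist S h (g⁻¹ * p n) = wdist S (g * h) (p n) := by
      rw [← wdist_mul_left g, mul_inv_cancel_left]
    have e₂ : wdist S 1 (g⁻¹ * p n) = wdist S g (p n) := by
      rw [← wdist_mul_left g, mul_inv_cancel_left, mul_one]
    rw [e₁, e₂] at hcmp
    rw [abs_le] at hcmp ⊢
    constructor <;> linarith
  · intro C
    by_contra hinf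
    rw [← Set.Infinite] at hinf
    have hball := hS.finite_wdist_one_le hSfin (3 * |C| + 8 * δ)
    obtain ⟨F, hF, hcard⟩ := hinf.exists_subset_card_eq (hball.toFinset.card + 1)
    obtain ⟨T, hT⟩ : ∃ T : ℕ, ∀ g ∈ F, wdist S g 1 ≤ T := by
      obtain ⟨T, hT⟩ := (F.image fun g => wordLength S (g⁻¹ * 1)).bddAbove
      exact ⟨T, fun g hg => Nat.cast_le.2 (hT (Finset.mem_coe.2 (Finset.mem_image_of_mem _ hg)))⟩
    have hall : ∀ᶠ n in U, ∀ g ∈ F, (T : ℝ) ≤ gromovProd S (p n) (g⁻¹ * p n) 1 ∧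
        wdist S g (p n) - wdist S 1 (p n) = β g := by
      rw [Finset.eventually_all]
      intro g hg
      exact ((hH g⁻¹ (H.inv_mem (hF hg).1)).eventually_ge_atTop _).and (hβ g)
    have hlong := (hH 1 H.one_mem).eventually_ge_atTop (T : ℝ)
    obtain ⟨n, hn, hTn⟩ := (hall.and hlong).exists
    have hTn' := hTn.trans (hS.gromovProd_le_left _ _ _)
    rw [hS.wdist_comm] at hTn'
    obtain ⟨t, ht, htT⟩ := hS.exists_liesBetween 1 (p n) hTn'
    have hdisp : ∀ g ∈ F, t⁻¹ * g⁻¹ * t ∈ hball.toFinset := by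
      intro g hg
      rw [Set.Finite.mem_toFinset, Set.mem_ofPred_eq]
      have := hS.wdist_mul_le_of_busemann hδ hhyp (g := g⁻¹) (abs_nonneg C) ht
        (by rw [htT, inv_inv]; exact hT g hg) (by rw [htT]; exact (hn g hg).1)
        (by rw [inv_inv, (hn g hg).2]; exact (hF hg).2.trans (le_abs_self C))
      rwa [← wdist_mul_left t, mul_one, ← mul_assoc, mul_inv_cancel_left]
    have hle := Finset.card_le_card_of_injOn (fun g => t⁻¹ * g⁻¹ * t) hdisp
      fun a _ b _ hab => by simpa using hab
    omega

/-- The stabilizer of the direction defined by the sequence `p`, where convergence is measured along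
the filter `U` with a linear rate. -/
def directionStabilizer (hS : IsSymmGen S) {δ : ℝ} (hhyp : IsHyperbolicWith S δ) (U : Filter ℕ)
    (p : ℕ → G) : Subgroup G where
  carrier := {g | ∃ C : ℝ, ∀ᶠ n : ℕ in U,
    min (n : ℝ) (wdist S (p n) 1) - C ≤ gromovProd S (p n) (g * p n) 1}
  one_mem' := ⟨0, Eventually.of_forall fun n => by
    have : gromovProd S (p n) (p n) 1 = wdist S (p n) 1 := by
      rw [gromovProd, wdist_self]
      ring
    rw [one_mul, this, sub_zero]
    exact min_le_right _ _⟩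
  mul_mem' := by
    rintro g h ⟨C, hC⟩ ⟨D, hD⟩
    refine ⟨max C (D + wdist S 1 g) + δ, ?_⟩
    filter_upwards [hC, hD] with n hg hh
    have h₁ := hhyp.1 (p n) (g * (h * p n)) (g * p n) 1
    have h₂ := hS.gromovProd_le_mul_left g (p n) (h * p n)
    rw [hS.gromovProd_comm (g * p n)] at h₂
    rw [mul_assoc]
    refine le_trans ?_ h₁
    rw [← sub_sub]
    gcongr
    refine le_min ?_ ?_
    · linarith [le_max_left C (D + wdist S 1 g)]
    · linarith [le_max_right C (D + wdist S 1 g)]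
  inv_mem' := by
    rintro g ⟨C, hC⟩
    refine ⟨C + wdist S 1 g⁻¹, ?_⟩
    filter_upwards [hC] with n hn
    have h := hS.gromovProd_le_mul_left g⁻¹ (p n) (g * p n)
    rw [inv_mul_cancel_left, hS.gromovProd_comm (g⁻¹ * p n)] at h
    linarith

/-- In a non-elementary hyperbolic group, any two points `p`, `q` can be moved away from the
direction of any `y` by an element of bounded length. -/
theorem IsSymmGen.exists_gromovProd_le_of_nonelementary (hS : IsSymmGen S) (hSfin : S.Finite)
    {δ : ℝ} (hδ : 0 ≤ δ) (hhyp : IsHyperbolicWith S δ)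
    (hne : ∀ g : G, (Subgroup.zpowers g).index = 0) :
    ∃ K : ℝ, ∀ y p q : G, ∃ h : G, wdist S 1 h ≤ K ∧
      gromovProd S y (h * p) 1 ≤ K ∧ gromovProd S y (h * q) 1 ≤ K := by
  have : Infinite G := by
    by_contra hG
    rw [not_infinite_iff_finite] at hG
    exact Subgroup.index_ne_zero_of_finite (hne 1)
  by_contra! hcon
  choose y p₀ q₀ hyp using fun n : ℕ => hcon n
  let p : Bool → ℕ → G := fun i n => if i then p₀ n else q₀ n
  let U : Ultrafilter ℕ := hyperfilter ℕ
  have hU : (U : Filter ℕ) ≤ atTop := Nat.hyperfilter_le_atTop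
  let P : Bool → Set G := fun i => {h | ∀ᶠ n : ℕ in U, (n : ℝ) ≤ gromovProd S (y n) (h * p i n) 1}
  have hcover : ∀ h : G, ∃ i, h ∈ P i := by
    intro h
    have hev : ∀ᶠ n : ℕ in U, (n : ℝ) ≤ gromovProd S (y n) (h * p true n) 1 ∨
        (n : ℝ) ≤ gromovProd S (y n) (h * p false n) 1 := by
      filter_upwards [(tendsto_natCast_atTop_atTop.mono_left hU).eventually_ge_atTop (wdist S 1 h)]
        with n hn
      by_cases hp : gromovProd S (y n) (h * p₀ n) 1 ≤ n
      · exact Or.inr (hyp n h hn hp).le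
      · exact Or.inl (not_le.1 hp).le
    rcases Ultrafilter.eventually_or.1 hev with h' | h'
    exacts [⟨true, h'⟩, ⟨false, h'⟩]
  classical
  let s : Finset Bool := Finset.univ.filter fun i => (P i).Nonempty
  let a : Bool → G := fun i => if hi : (P i).Nonempty then hi.some else 1
  have ha : ∀ i ∈ s, a i ∈ P i := by
    intro i hi
    have hi' : (P i).Nonempty := (Finset.mem_filter.1 hi).2
    simp only [a, dif_pos hi']
    exact hi'.some_mem
  have hlong : ∀ i ∈ s, ∀ᶠ n : ℕ in U, n - wdist S 1 (a i) ≤ wdist S (p i n) 1 := by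
    intro i hi
    filter_upwards [ha i hi] with n hn
    have h₁ := hn.trans (hS.gromovProd_le_right _ _ _)
    have h₂ := hS.wdist_triangle 1 (a i) (a i * p i n)
    have h₃ := wdist_mul_left (S := S) (a i) 1 (p i n)
    rw [mul_one] at h₃
    rw [hS.wdist_comm] at h₁
    rw [hS.wdist_comm (p i n)]
    linarith
  let H : Bool → Subgroup G := fun i => directionStabilizer hS hhyp U (p i)
  have hunion : ⋃ i ∈ s, a i • (H i : Set G) = Set.univ := by
    refine Set.eq_univ_of_forall fun h => ?_
    obtain ⟨i, hi⟩ := hcover h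
    have his : i ∈ s := Finset.mem_filter.2 ⟨Finset.mem_univ _, h, hi⟩
    refine Set.mem_biUnion his ?_
    rw [Set.mem_smul_set_iff_inv_smul_mem, smul_eq_mul]
    refine ⟨δ + wdist S 1 (a i)⁻¹, ?_⟩
    filter_upwards [ha i his, hi] with n h₁ h₂
    have h₃ := hhyp.1 (a i * p i n) (h * p i n) (y n) 1
    rw [hS.gromovProd_comm _ (y n), hS.gromovProd_comm _ (y n)] at h₃
    have h₄ := hS.gromovProd_le_mul_left (a i)⁻¹ (a i * p i n) (h * p i n)
    rw [inv_mul_cancel_left, ← mul_assoc] at h₄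
    have h₅ := le_min h₁ h₂
    have h₆ := min_le_left (n : ℝ) (wdist S (p i n) 1)
    linarith
  obtain ⟨i, hi, hfi⟩ := Subgroup.exists_finiteIndex_of_leftCoset_cover hunion
  obtain ⟨g, hg⟩ := hS.exists_index_zpowers_ne_zero_of_tendsto hSfin hδ hhyp U (p i) (H i) <| by
    rintro g ⟨C, hC⟩
    have htend : Tendsto (fun n : ℕ => (n : ℝ) + (-wdist S 1 (a i) - C)) U atTop :=
      tendsto_atTop_add_const_right _ _ (tendsto_natCast_atTop_atTop.mono_left hU)
    refine tendsto_atTop_mono' _ ?_ htend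
    filter_upwards [hC, hlong i hi] with n h₁ h₂
    have : n - wdist S 1 (a i) ≤ min (n : ℝ) (wdist S (p i n) 1) :=
      le_min (by linarith [wdist_nonneg (S := S) 1 (a i)]) h₂
    linarith
  exact hg (hne g)

/-- If the directions of `b` and `b⁻¹` are both far from that of `x⁻¹` and `b` is long, then the
concatenation `1, x, x b, x b x⁻¹` is almost geodesic at `x`. -/
theorem IsSymmGen.gromovProd_conj_le (hS : IsSymmGen S) {δ K : ℝ} (hhyp : IsHyperbolicWith S δ)
    {x b : G} (hb : gromovProd S x⁻¹ b 1 ≤ K) (hb' : gromovProd S x⁻¹ b⁻¹ 1 ≤ K)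
    (hlong : 2 * K + δ < wdist S 1 b) :
    gromovProd S 1 (x * b * x⁻¹) x ≤ K + δ := by
  have e₁ : gromovProd S 1 (x * b * x⁻¹) x = gromovProd S x⁻¹ (b * x⁻¹) 1 := by
    rw [← gromovProd_mul_left x⁻¹]
    simp [mul_assoc]
  have e₂ : gromovProd S b (b * x⁻¹) 1 = wdist S 1 b - gromovProd S x⁻¹ b⁻¹ 1 := by
    have h₁ : wdist S x⁻¹ b⁻¹ = wdist S (b * x⁻¹) 1 := by
      rw [← wdist_mul_left b, mul_inv_cancel]
    have h₂ : wdist S b (b * x⁻¹) = wdist S x⁻¹ 1 := by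
      rw [hS.wdist_comm x⁻¹, ← wdist_mul_left b 1, mul_one]
    have h₃ : wdist S b⁻¹ 1 = wdist S 1 b := by
      rw [← wdist_mul_left b, mul_inv_cancel, mul_one]
    simp only [gromovProd, h₁, h₂, h₃, hS.wdist_comm b 1]
    ring
  have h := hhyp.1 x⁻¹ b (b * x⁻¹) 1
  rw [e₁]
  by_contra! hlt
  have := lt_min hlt (show K + δ < gromovProd S b (b * x⁻¹) 1 by linarith)
  linarith

theorem IsSymmGen.isQuasiconvex_of_quasidense (hS : IsSymmGen S) {A : Set G}
    (hA : Quasidense A) : IsQuasiconvex S A := by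
  obtain ⟨T, hT⟩ := hA
  refine ⟨∑ t ∈ T, wdist S 1 t, Finset.sum_nonneg fun t _ => wdist_nonneg 1 t, ?_⟩
  intro x _ y _ z _
  obtain ⟨q, hq, t, ht, rfl⟩ := hT (Set.mem_univ z)
  refine ⟨q, hq, ?_⟩
  have : wdist S (q * t) q = wdist S 1 t := by
    rw [hS.wdist_comm, ← wdist_mul_left q 1, mul_one]
  simp only [this]
  exact Finset.single_le_sum (f := fun t => wdist S 1 t) (fun t _ => wdist_nonneg 1 t) ht

theorem IsSymmGen.quasidense_of_forall_wdist_le (hS : IsSymmGen S) (hSfin : S.Finite) {A : Set G}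
    {M : ℝ} (hA : ∀ x, ∃ q ∈ A, wdist S q x ≤ M) : Quasidense A := by
  refine ⟨(hS.finite_wdist_one_le hSfin M).toFinset, fun x _ => ?_⟩
  obtain ⟨q, hq, hd⟩ := hA x
  refine ⟨q, hq, q⁻¹ * x, ?_, mul_inv_cancel_left q x⟩
  rw [Set.Finite.coe_toFinset, Set.mem_ofPred_eq, ← wdist_mul_left q, mul_one, mul_inv_cancel_left]
  exact hd

end Geometry

/-- Let `G` be a non-elementary `δ`-hyperbolic group (no cyclic subgroup of `G` has finite
index) and let `A ⊆ G` contain an infinite normal subset `B` (so `gBg⁻¹ = B` for all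
`g ∈ G`).  Then `A` is quasiconvex if and only if `A` is quasidense in `G`. -/
theorem quasiconvex_iff_quasidense_of_contains_infinite_normal_subset
    {G : Type*} [Group G] (S : Set G) (hSfin : S.Finite)
    (hSsym : ∀ s ∈ S, s⁻¹ ∈ S) (hSgen : Subgroup.closure S = ⊤)
    (δ : ℝ) (hδ : 0 ≤ δ) (hhyp : IsHyperbolicWith S δ)
    (hne : ∀ g : G, (Subgroup.zpowers g).index = 0)
    (A B : Set G) (hBA : B ⊆ A) (hBinf : B.Infinite)
    (hBnormal : ∀ g : G, (fun x => g * x * g⁻¹) '' B = B) :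
    IsQuasiconvex S A ↔ Quasidense A := by
  have hS : IsSymmGen S := ⟨hSsym, hSgen⟩
  refine ⟨?_, hS.isQuasiconvex_of_quasidense⟩
  rintro ⟨ε, -, hε⟩
  obtain ⟨K, hK⟩ := hS.exists_gromovProd_le_of_nonelementary hSfin hδ hhyp hne
  obtain ⟨b, hbB, hb⟩ : ∃ b ∈ B, 2 * (K + K) + δ < wdist S 1 b := by
    by_contra! hcon
    exact hBinf ((hS.finite_wdist_one_le hSfin _).subset hcon)
  refine hS.quasidense_of_forall_wdist_le hSfin
    (M := ε + (K + K + δ + wdist S 1 b + 1 + 2 * δ) + K) fun x => ?_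
  obtain ⟨h, hh, hp, hq⟩ := hK x⁻¹ b b⁻¹
  have hshift : ∀ c, gromovProd S x⁻¹ (h * c) 1 ≤ K → gromovProd S (x * h)⁻¹ c 1 ≤ K + K := by
    intro c hc
    have := hS.gromovProd_le_mul_left h (h⁻¹ * x⁻¹) c
    rw [mul_inv_cancel_left] at this
    rw [mul_inv_rev]
    linarith
  have hprod := hS.gromovProd_conj_le hhyp (hshift b hp) (hshift b⁻¹ hq) hb
  have hconj : x * h * b * (x * h)⁻¹ ∈ B := by
    rw [← hBnormal (x * h)]
    exact ⟨b, hbB, rfl⟩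
  obtain ⟨z, hz, hzd⟩ := hS.exists_liesBetween_wdist_le hhyp b (x * h * b * (x * h)⁻¹) (x * h)
  obtain ⟨q, hqA, hqd⟩ := hε b (hBA hbB) _ (hBA hconj) z hz
  refine ⟨q, hqA, ?_⟩
  have h₁ := hS.gromovProd_le_add_wdist_left b 1 (x * h * b * (x * h)⁻¹) (x * h)
  have h₂ := hS.wdist_triangle q z x
  have h₃ := hS.wdist_triangle z (x * h) x
  have h₄ : wdist S (x * h) x = wdist S 1 h := by
    rw [hS.wdist_comm, ← wdist_mul_left x 1, mul_one]
  rw [hS.wdist_comm b 1] at h₁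
  rw [hS.wdist_comm q z] at h₂
  rw [hS.wdist_comm z (x * h)] at h₃
  linarith
end
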